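/- Let P be a finite poset, K a field, and let (C, π) be a strict P-graded chain complex. If (ψ, φ, γ) is a P-graded reduction from (C, π) to a P-graded chain complex (M, π) (i.e., ψ, φ and all γ_n are P-filtered), then (M, π) is strict, and each φ_n is a linear isomorphism with inverse ψ_n; in particular (M, π) and (C, π) are P-filtered chain isomorphic. -/

import Mathlib

/-- A family of projections giving a `P`-grading of a vector space `V`. -/
def IsGrading {K : Type*} [Field K] {P : Type*} [Fintype P]
    {V : Type*} [AddCommGroup V] [Module K V] (π : P → V →ₗ[K] V) : Prop :=
  (∀ p, π p ∘ₗ π p = π p) ∧ (∑ p, π p) = LinearMap.id ∧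
    (∀ p q, p ≠ q → π p ∘ₗ π q = 0)

/-- A linear map between `P`-graded vector spaces is `P`-filtered if its
`(p,q)`-component is nonzero only when `p ≤ q`. -/
def IsFilteredMap {K : Type*} [Field K] {P : Type*} [PartialOrder P]
    {V W : Type*} [AddCommGroup V] [Module K V] [AddCommGroup W] [Module K W]
    (πV : P → V →ₗ[K] V) (πW : P → W →ₗ[K] W) (φ : V →ₗ[K] W) : Prop :=
  ∀ p q : P, πW p ∘ₗ φ ∘ₗ πV q ≠ 0 → p ≤ q

section Filtered

variable {K : Type*} [Field K] {P : Type*}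
  {V W X : Type*} [AddCommGroup V] [Module K V] [AddCommGroup W] [Module K W]
  [AddCommGroup X] [Module K X]
  {πV : P → V →ₗ[K] V} {πW : P → W →ₗ[K] W} {πX : P → X →ₗ[K] X}

section Grading

variable [Fintype P]

theorem IsGrading.sum_apply (h : IsGrading πV) (x : V) : ∑ p, πV p x = x := by
  simpa using LinearMap.congr_fun h.2.1 x

theorem IsGrading.apply_apply (h : IsGrading πV) (p : P) (x : V) :
    πV p (πV p x) = πV p x :=
  LinearMap.congr_fun (h.1 p) x

/-- The components of a composition are given by the matrix product. -/
theorem IsGrading.comp_component (hW : IsGrading πW) (f : V →ₗ[K] W) (g : W →ₗ[K] X)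
    (p q : P) (x : V) :
    πX p (g (f (πV q x))) = ∑ r, πX p (g (πW r (πW r (f (πV q x))))) := by
  simp only [hW.apply_apply, ← map_sum, hW.sum_apply]

end Grading

variable [PartialOrder P]

theorem IsFilteredMap.apply_eq_zero {f : V →ₗ[K] W} (hf : IsFilteredMap πV πW f) {p q : P}
    (hpq : ¬ p ≤ q) (x : V) : πW p (f (πV q x)) = 0 :=
  LinearMap.congr_fun (not_not.1 (mt (hf p q) hpq)) x

theorem IsFilteredMap.add {f g : V →ₗ[K] W} (hf : IsFilteredMap πV πW f)
    (hg : IsFilteredMap πV πW g) : IsFilteredMap πV πW (f + g) := by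
  intro p q
  contrapose
  intro hpq
  ext x
  simp [hf.apply_eq_zero hpq, hg.apply_eq_zero hpq]

variable [Fintype P]

theorem IsFilteredMap.comp (hW : IsGrading πW) {f : V →ₗ[K] W} {g : W →ₗ[K] X}
    (hf : IsFilteredMap πV πW f) (hg : IsFilteredMap πW πX g) :
    IsFilteredMap πV πX (g ∘ₗ f) := by
  intro p q
  contrapose
  intro hpq
  ext x
  refine (hW.comp_component f g p q x).trans (Finset.sum_eq_zero fun r _ => ?_)
  by_cases hpr : p ≤ r
  · rw [hf.apply_eq_zero fun hrq => hpq (hpr.trans hrq)]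
    simp
  · exact hg.apply_eq_zero hpr _

/-- The diagonal components of a composition of filtered maps are the compositions of the
diagonal components. -/
theorem IsFilteredMap.comp_diagonal (hW : IsGrading πW) {f : V →ₗ[K] W} {g : W →ₗ[K] X}
    (hf : IsFilteredMap πV πW f) (hg : IsFilteredMap πW πX g) (p : P) (x : V) :
    πX p (g (f (πV p x))) = πX p (g (πW p (πW p (f (πV p x))))) := by
  refine (hW.comp_component f g p p x).trans (Finset.sum_eq_single p (fun r _ hr => ?_) (by simp))
  by_cases hpr : p ≤ r
  · rw [hf.apply_eq_zero fun hrp => hr (hrp.antisymm hpr)]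
    simp
  · exact hg.apply_eq_zero hpr _

/-- A filtered idempotent with zero diagonal vanishes. -/
theorem IsFilteredMap.eq_zero_of_idempotent (hV : IsGrading πV) {e : V →ₗ[K] V}
    (he : IsFilteredMap πV πV e) (hdiag : ∀ p x, πV p (e (πV p x)) = 0)
    (hidem : ∀ x, e (e x) = e x) (x : V) : e x = 0 := by
  have key : ∀ p, πV p (e x) = 0 := by
    intro p
    induction p using WellFoundedGT.induction with
    | ind p ih =>
      rw [← hidem, ← hV.sum_apply (e x), map_sum, map_sum]
      refine Finset.sum_eq_zero fun r _ => ?_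
      by_cases hpr : p ≤ r
      · rcases hpr.eq_or_lt with rfl | hlt
        · exact hdiag p _
        · rw [ih r hlt]
          simp
      · exact he.apply_eq_zero hpr _
  rw [← hV.sum_apply (e x)]
  exact Finset.sum_eq_zero fun p _ => key p

end Filtered

/-- A P-graded reduction of a strict P-graded chain complex
(C, π) onto (M, π) forces (M, π) to be strict, and the maps φ, ψ of the
reduction are mutually inverse isomorphisms; in particular (M, π) and (C, π)
are P-filtered chain isomorphic. -/
theorem stmt_12 {K : Type*} [Field K] {P : Type*} [PartialOrder P] [Fintype P]
    {C M : ℤ → Type*}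
    [∀ n, AddCommGroup (C n)] [∀ n, Module K (C n)]
    [∀ n, AddCommGroup (M n)] [∀ n, Module K (M n)]
    (πC : ∀ n : ℤ, P → C n →ₗ[K] C n) (πM : ∀ n : ℤ, P → M n →ₗ[K] M n)
    (hgrC : ∀ n, IsGrading (πC n)) (hgrM : ∀ n, IsGrading (πM n))
    (dC : ∀ n : ℤ, C (n + 1) →ₗ[K] C n) (dM : ∀ n : ℤ, M (n + 1) →ₗ[K] M n)
    (hdfC : ∀ n, IsFilteredMap (πC (n + 1)) (πC n) (dC n))
    (hdfM : ∀ n, IsFilteredMap (πM (n + 1)) (πM n) (dM n))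
    (hddC : ∀ (n : ℤ) (x : C (n + 1 + 1)), dC n (dC (n + 1) x) = 0)
    (hddM : ∀ (n : ℤ) (x : M (n + 1 + 1)), dM n (dM (n + 1) x) = 0)
    -- (C, π) is strict
    (hstrictC : ∀ (n : ℤ) (p : P), πC n p ∘ₗ dC n ∘ₗ πC (n + 1) p = 0)
    -- the reduction maps, all P-filtered
    (ψ : ∀ n, C n →ₗ[K] M n) (φ : ∀ n, M n →ₗ[K] C n)
    (γ : ∀ n : ℤ, C n →ₗ[K] C (n + 1))
    (hψf : ∀ n, IsFilteredMap (πC n) (πM n) (ψ n))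
    (hφf : ∀ n, IsFilteredMap (πM n) (πC n) (φ n))
    (hγf : ∀ n, IsFilteredMap (πC n) (πC (n + 1)) (γ n))
    -- the reduction identities
    (hψ : ∀ (n : ℤ) (x : C (n + 1)), ψ n (dC n x) = dM n (ψ (n + 1) x))
    (hφ : ∀ (n : ℤ) (x : M (n + 1)), φ n (dM n x) = dC n (φ (n + 1) x))
    (hψφ : ∀ (n : ℤ) (x : M n), ψ n (φ n x) = x)
    (hφψ : ∀ (n : ℤ) (x : C (n + 1)),
      φ (n + 1) (ψ (n + 1) x) = x - (γ n (dC n x) + dC (n + 1) (γ (n + 1) x)))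
    (hγγ : ∀ (n : ℤ) (x : C n), γ (n + 1) (γ n x) = 0)
    (hγφ : ∀ (n : ℤ) (x : M n), γ n (φ n x) = 0)
    (hψγ : ∀ (n : ℤ) (x : C n), ψ (n + 1) (γ n x) = 0) :
    (∀ (n : ℤ) (p : P), πM n p ∘ₗ dM n ∘ₗ πM (n + 1) p = 0) ∧
    (∀ n, Function.Bijective (φ n)) ∧
    (∀ (n : ℤ) (x : C n), φ n (ψ n x) = x) ∧
    (∀ (n : ℤ) (x : M n), ψ n (φ n x) = x) := by
  have inv : ∀ (n : ℤ) (x : C n), φ n (ψ n x) = x := by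
    intro n
    obtain ⟨n, rfl⟩ : ∃ m, n = m + 1 := ⟨n - 1, by ring⟩
    let e := γ n ∘ₗ dC n + dC (n + 1) ∘ₗ γ (n + 1)
    have he : ∀ x, e x = x - φ (n + 1) (ψ (n + 1) x) := fun x => by
      rw [hφψ, sub_sub_cancel]
      rfl
    have hef : IsFilteredMap (πC (n + 1)) (πC (n + 1)) e :=
      ((hdfC n).comp (hgrC n) (hγf n)).add
        ((hγf (n + 1)).comp (hgrC (n + 1 + 1)) (hdfC (n + 1)))
    have hdiag : ∀ p x, πC (n + 1) p (e (πC (n + 1) p x)) = 0 := by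
      intro p x
      have hd : πC n p (dC n (πC (n + 1) p x)) = 0 := LinearMap.congr_fun (hstrictC n p) x
      have hd' : ∀ y, πC (n + 1) p (dC (n + 1) (πC (n + 1 + 1) p y)) = 0 :=
        LinearMap.congr_fun (hstrictC (n + 1) p)
      simp only [e, LinearMap.add_apply, LinearMap.comp_apply, map_add]
      rw [(hdfC n).comp_diagonal (hgrC n) (hγf n),
        (hγf (n + 1)).comp_diagonal (hgrC (n + 1 + 1)) (hdfC (n + 1)), hd, hd']
      simp
    intro x
    have hzero := hef.eq_zero_of_idempotent (hgrC (n + 1)) hdiag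
      (fun x => by simp [he, hψφ]) x
    rw [he, sub_eq_zero] at hzero
    exact hzero.symm
  refine ⟨fun n p => ?_, fun n => ⟨Function.LeftInverse.injective (hψφ n),
    Function.RightInverse.surjective (inv n)⟩, inv, hψφ⟩
  ext x
  have hdφ : IsFilteredMap (πM (n + 1)) (πC n) (dC n ∘ₗ φ (n + 1)) :=
    (hφf (n + 1)).comp (hgrC (n + 1)) (hdfC n)
  have hd : ∀ y, πC n p (dC n (πC (n + 1) p y)) = 0 := LinearMap.congr_fun (hstrictC n p)
  have hφd : πC n p (dC n (φ (n + 1) (πM (n + 1) p x))) = 0 := by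
    rw [(hφf (n + 1)).comp_diagonal (hgrC (n + 1)) (hdfC n), hd]
  calc πM n p (dM n (πM (n + 1) p x))
      = πM n p (ψ n ((dC n ∘ₗ φ (n + 1)) (πM (n + 1) p x))) := by
        rw [LinearMap.comp_apply, ← hφ, hψφ]
    _ = 0 := by
        rw [hdφ.comp_diagonal (hgrC n) (hψf n), LinearMap.comp_apply, hφd]
        simp
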